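/- arXiv:2407.00058 — 3 statements merged into one kernel-verified Lean document; each statement's English description precedes it below -/
import Mathlib

section
/- For all j ≥ 0 and all n ≥ 0, a_{5j+1}(5n+4) ≡ 0 (mod 5). -/
/-- The set of generalized cubic partitions of `n` with `c` colors for even parts:
a partition is encoded as a multiset of (part, color) pairs, where each part is positive,
even parts carry a color `< c`, and odd parts carry the single color `0`. -/
def cubicPartitionSet (c n : ℕ) : Set (Multiset (ℕ × ℕ)) :=
  {M | (∀ x ∈ M, 0 < x.1 ∧ (if Even x.1 then x.2 < c else x.2 = 0)) ∧
    (M.map Prod.fst).sum = n}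

/-- `a c n` is the number of generalized cubic partitions of `n` with `c` colors. -/
noncomputable def a (c n : ℕ) : ℕ := (cubicPartitionSet c n).ncard

namespace CubicPartition

open PowerSeries Finset

section Pentagonal

variable (R : Type*) [CommRing R]

/-- The part of the pentagonal series indexed by the integers congruent to `r` modulo `5`. -/
noncomputable def pentagonalPart (r : ZMod 5) : R⟦X⟧ :=
  .mk fun n ↦ ∑ k ∈ Icc (-n : ℤ) n,
    if pentagonal k = n ∧ (k : ZMod 5) = r then (Int.negOnePow k : R) else 0

theorem abs_le_pentagonal (k : ℤ) : |k| ≤ pentagonal k := by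
  have h := two_mul_natCast_pentagonal k
  rcases abs_cases k with ⟨hk, h0⟩ | ⟨hk, h0⟩ <;> rw [hk]
  · rcases h0.eq_or_lt with rfl | h1
    · simp
    · nlinarith
  · nlinarith

theorem coeff_pentagonalPart (r : ZMod 5) {n N : ℕ} (h : n ≤ N) :
    coeff n (pentagonalPart R r) = ∑ k ∈ Icc (-N : ℤ) N,
      if pentagonal k = n ∧ (k : ZMod 5) = r then (Int.negOnePow k : R) else 0 := by
  rw [pentagonalPart, coeff_mk]
  refine sum_subset (fun k hk ↦ ?_) fun k _ hk ↦ if_neg ?_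
  · simp only [mem_Icc] at hk ⊢
    omega
  · rintro ⟨rfl, -⟩
    exact hk (mem_Icc.2 (abs_le.1 (abs_le_pentagonal k)))

theorem sum_pentagonalPart : ∑ r, pentagonalPart R r = pentagonalSeries R := by
  ext n
  rw [map_sum]
  simp_rw [coeff_pentagonalPart R _ le_rfl]
  rw [sum_comm]
  have key (k : ℤ) : (∑ r : ZMod 5, if pentagonal k = n ∧ (k : ZMod 5) = r then
      (Int.negOnePow k : R) else 0) = if pentagonal k = n then (Int.negOnePow k : R) else 0 := by
    by_cases h : pentagonal k = n <;> simp [h]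
  simp_rw [key]
  by_cases h : n ∈ Set.range pentagonal
  · obtain ⟨k, rfl⟩ := h
    rw [coeff_pentagonalSeries_pentagonal, sum_eq_single k]
    · simp
    · intro b _ hb
      simp [hb]
    · intro hk
      exact absurd (mem_Icc.2 (abs_le.1 (abs_le_pentagonal k))) hk
  · rw [coeff_pentagonalSeries_eq_zero R h]
    exact sum_eq_zero fun k _ ↦ if_neg fun hk ↦ h ⟨k, hk⟩

theorem coeff_pentagonalPart_mul (r s : ZMod 5) (N : ℕ) :
    coeff N (pentagonalPart R r * pentagonalPart R s) =
      ∑ p ∈ Icc (-N : ℤ) N ×ˢ Icc (-N : ℤ) N,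
        if pentagonal p.1 + pentagonal p.2 = N ∧ (p.1 : ZMod 5) = r ∧ (p.2 : ZMod 5) = s then
          (Int.negOnePow p.1 : R) * (Int.negOnePow p.2 : R) else 0 := by
  rw [coeff_mul, sum_product]
  have h1 : ∀ p ∈ antidiagonal N, coeff p.1 (pentagonalPart R r) * coeff p.2 (pentagonalPart R s) =
      ∑ k ∈ Icc (-N : ℤ) N, ∑ l ∈ Icc (-N : ℤ) N,
        (if pentagonal k = p.1 ∧ (k : ZMod 5) = r then (Int.negOnePow k : R) else 0) *
        (if pentagonal l = p.2 ∧ (l : ZMod 5) = s then (Int.negOnePow l : R) else 0) := by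
    intro p hp
    rw [coeff_pentagonalPart R r (Nat.le.intro (HasAntidiagonal.mem_antidiagonal.1 hp)),
      coeff_pentagonalPart R s (Nat.le_of_add_left_le (HasAntidiagonal.mem_antidiagonal.1 hp).le),
      sum_mul_sum]
  rw [sum_congr rfl h1, sum_comm]
  refine sum_congr rfl fun k _ ↦ ?_
  rw [sum_comm]
  refine sum_congr rfl fun l _ ↦ ?_
  split_ifs with h
  · obtain ⟨h, hk, hl⟩ := h
    rw [sum_eq_single (pentagonal k, pentagonal l)]
    · simp [hk, hl]
    · rintro ⟨x, y⟩ _ hxy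
      by_cases hx : pentagonal k = x
      · have hy : pentagonal l ≠ y := fun hy ↦ hxy (by simp [hx, hy])
        simp [hy]
      · simp [hx]
    · intro h'
      exact absurd (HasAntidiagonal.mem_antidiagonal.2 h) h'
  · refine sum_eq_zero fun p hp ↦ ?_
    rw [HasAntidiagonal.mem_antidiagonal] at hp
    split_ifs <;> try simp
    grind

/-- With `m = 6 * k - 1`, the involution is a reflection of the lattice points `(m, m')` divisible
by `2 + i`, namely the one with matrix `(1/5) [[3, -4], [-4, -3]]`. It reverses signs. -/
theorem sum_pentagonalPart_mul_eq_zero :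
    ∑ r : ZMod 5, pentagonalPart R r * pentagonalPart R (2 * r - 1) = 0 := by
  ext N
  rw [map_sum, map_zero]
  simp_rw [coeff_pentagonalPart_mul]
  rw [sum_comm]
  have key (p : ℤ × ℤ) : (∑ r : ZMod 5,
      if pentagonal p.1 + pentagonal p.2 = N ∧ (p.1 : ZMod 5) = r ∧ (p.2 : ZMod 5) = 2 * r - 1 then
        (Int.negOnePow p.1 : R) * (Int.negOnePow p.2 : R) else 0) =
      if pentagonal p.1 + pentagonal p.2 = N ∧ 5 ∣ p.2 - 2 * p.1 + 1 then
        (Int.negOnePow p.1 : R) * (Int.negOnePow p.2 : R) else 0 := by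
    have h5 : (5 : ℤ) ∣ p.2 - 2 * p.1 + 1 ↔ (p.2 : ZMod 5) = 2 * (p.1 : ZMod 5) - 1 := by
      rw [← sub_eq_zero]
      have := ZMod.intCast_zmod_eq_zero_iff_dvd (p.2 - 2 * p.1 + 1) 5
      push_cast at this
      rw [← this]
      ring_nf
    rw [sum_eq_single (p.1 : ZMod 5)]
    · simp [h5]
    · intro r _ hr
      exact if_neg fun h ↦ hr h.2.1.symm
    · simp
  simp_rw [key]
  rw [← sum_filter]
  have hbound {k l : ℤ} (h : pentagonal k + pentagonal l = N) :
      (k, l) ∈ Icc (-N : ℤ) N ×ˢ Icc (-N : ℤ) N := by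
    have hk := abs_le.1 (abs_le_pentagonal k)
    have hl := abs_le.1 (abs_le_pentagonal l)
    simp only [mem_product, mem_Icc]
    omega
  refine sum_involution
    (fun p _ ↦ ((3 * p.1 - 4 * p.2 + 1) / 5, (2 - 4 * p.1 - 3 * p.2) / 5)) ?_ ?_ ?_ ?_
  all_goals
    rintro ⟨k, l⟩ hp
    obtain ⟨-, hN, t, ht⟩ := mem_filter.1 hp
    simp only at hN ht
    obtain rfl : l = 2 * k - 1 + 5 * t := by omega
    have e1 : (3 * k - 4 * (2 * k - 1 + 5 * t) + 1) / 5 = 1 - k - 4 * t := by omega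
    have e2 : (2 - 4 * k - 3 * (2 * k - 1 + 5 * t)) / 5 = 1 - 2 * k - 3 * t := by omega
    simp only [e1, e2]
  · have hsign : Int.negOnePow (1 - k - 4 * t) * Int.negOnePow (1 - 2 * k - 3 * t) =
        -(Int.negOnePow k * Int.negOnePow (2 * k - 1 + 5 * t)) := by
      rw [← Int.negOnePow_add, ← Int.negOnePow_add, ← Int.negOnePow_succ,
        Int.negOnePow_eq_iff]
      exact ⟨1 - 3 * k - 6 * t, by ring⟩
    have := congrArg (fun u : ℤˣ ↦ ((u : ℤ) : R)) hsign
    simp only [Units.val_mul, Units.val_neg, Int.cast_mul, Int.cast_neg] at this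
    rw [this, add_neg_cancel]
  · intro _ h
    simp only [Prod.mk.injEq] at h
    omega
  · have hN' : pentagonal (1 - k - 4 * t) + pentagonal (1 - 2 * k - 3 * t) = N := by
      rw [← hN]
      have h1 := two_mul_natCast_pentagonal k
      have h2 := two_mul_natCast_pentagonal (2 * k - 1 + 5 * t)
      have h3 := two_mul_natCast_pentagonal (1 - k - 4 * t)
      have h4 := two_mul_natCast_pentagonal (1 - 2 * k - 3 * t)
      zify
      linarith
    exact mem_filter.2 ⟨hbound hN', hN', t, by ring⟩
  · ext <;> simp only <;> omega

end Pentagonal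

section Residue

variable {R : Type*} [CommRing R]

/-- The power series `f` only has exponents congruent to `r` modulo `5`. -/
def SupportedOn (r : ZMod 5) (f : R⟦X⟧) : Prop := ∀ n : ℕ, coeff n f ≠ 0 → (n : ZMod 5) = r

theorem SupportedOn.coeff_eq_zero {r : ZMod 5} {f : R⟦X⟧} (hf : SupportedOn r f) {n : ℕ}
    (hn : (n : ZMod 5) ≠ r) : coeff n f = 0 :=
  not_not.1 fun h ↦ hn (hf n h)

theorem SupportedOn.add {r : ZMod 5} {f g : R⟦X⟧} (hf : SupportedOn r f) (hg : SupportedOn r g) :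
    SupportedOn r (f + g) := by
  intro n h
  by_contra hn
  exact h (by rw [map_add, hf.coeff_eq_zero hn, hg.coeff_eq_zero hn, add_zero])

theorem SupportedOn.mul {r s : ZMod 5} {f g : R⟦X⟧} (hf : SupportedOn r f)
    (hg : SupportedOn s g) : SupportedOn (r + s) (f * g) := by
  intro n h
  rw [coeff_mul] at h
  obtain ⟨p, hp, h⟩ := exists_ne_zero_of_sum_ne_zero h
  rw [← hf _ (left_ne_zero_of_mul h), ← hg _ (right_ne_zero_of_mul h), ← Nat.cast_add,
    HasAntidiagonal.mem_antidiagonal.1 hp]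

theorem SupportedOn.pow {r : ZMod 5} {f : R⟦X⟧} (hf : SupportedOn r f) (m : ℕ) :
    SupportedOn (m * r) (f ^ m) := by
  induction m with
  | zero =>
    intro n h
    rw [pow_zero, coeff_one] at h
    simp_all
  | succ m ih =>
    have := ih.mul hf
    rw [pow_succ]
    convert this using 1
    push_cast
    ring

theorem supportedOn_pentagonalPart (r : ZMod 5) :
    SupportedOn (3 * r * (3 * r - 1)) (pentagonalPart R r) := by
  intro n h
  rw [pentagonalPart, coeff_mk] at h
  obtain ⟨k, -, h⟩ := exists_ne_zero_of_sum_ne_zero h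
  obtain ⟨rfl, rfl⟩ := (ite_ne_right_iff.1 h).1
  have := congrArg (Int.cast : ℤ → ZMod 5) (two_mul_natCast_pentagonal k)
  push_cast at this
  calc (pentagonal k : ZMod 5) = 3 * (2 * pentagonal k) := by
        rw [← mul_assoc, show (3 * 2 : ZMod 5) = 1 by decide, one_mul]
    _ = _ := by rw [this]; ring

theorem five_eq_zero : (5 : (ZMod 5)⟦X⟧) = 0 := by
  rw [← map_ofNat (C (R := ZMod 5)) 5, show (OfNat.ofNat 5 : ZMod 5) = 0 by decide, map_zero]

theorem supportedOn_pow_five (f : (ZMod 5)⟦X⟧) : SupportedOn 0 (f ^ 5) := by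
  intro n h
  cases n with
  | zero => simp
  | succ n =>
    have hd : d⁄dX (ZMod 5) (f ^ 5) = 0 := by
      rw [derivative_pow, Nat.cast_ofNat, five_eq_zero]
      simp
    have := congrArg (coeff n) hd
    rw [coeff_derivative, map_zero] at this
    push_cast
    have hp : Fact (Nat.Prime 5) := ⟨Nat.prime_five⟩
    exact (mul_eq_zero.1 this).resolve_left h

theorem coeff_pentagonalSeries_pow_four {n : ℕ} (hn : (n : ZMod 5) = 4) :
    coeff n (pentagonalSeries (ZMod 5) ^ 4) = 0 := by
  set e := pentagonalPart (ZMod 5)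
  have hs (r : ZMod 5) : SupportedOn (3 * r * (3 * r - 1)) (e r) := supportedOn_pentagonalPart r
  have h0 : SupportedOn 0 (e 0 + e 2) := (hs 0).add (hs 2)
  have h1 : SupportedOn 1 (e 1) := hs 1
  have h2 : SupportedOn 2 (e 3 + e 4) := (hs 3).add (hs 4)
  have hsum : pentagonalSeries (ZMod 5) = (e 0 + e 2) + e 1 + (e 3 + e 4) := by
    rw [← sum_pentagonalPart]
    refine (Fin.sum_univ_five _).trans ?_
    change e 0 + e 1 + e 2 + e 3 + e 4 = _
    ring
  have hrel : (e 0 + e 2) * (e 3 + e 4) = -e 1 ^ 2 := by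
    have h := (Fin.sum_univ_five _).symm.trans (sum_pentagonalPart_mul_eq_zero (ZMod 5))
    change e 0 * e 4 + e 1 * e 1 + e 2 * e 3 + e 3 * e 0 + e 4 * e 2 = 0 at h
    linear_combination h
  rw [hsum]
  generalize e 0 + e 2 = u, e 1 = v, e 3 + e 4 = w at *
  have hexp : (u + v + w) ^ 4 = u ^ 4 * v ^ 0 + 2 * (v ^ 3 * w ^ 1) + 2 * (v ^ 2 * w ^ 2) +
      2 * (u ^ 2 * v ^ 2) + 2 * (u ^ 1 * v ^ 3) + v ^ 0 * w ^ 4 - u ^ 3 * v ^ 1 - v ^ 1 * w ^ 3 := by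
    linear_combination (12 * v * w + 4 * w ^ 2 + 4 * u ^ 2 + 12 * u * v + 6 * (u * w + v ^ 2)) *
      hrel + (-2 * v ^ 3 * w + u ^ 3 * v + v * w ^ 3 - 2 * u * v ^ 3 - v ^ 4) * five_eq_zero
  have huv (i k : ℕ) (hne : (4 : ZMod 5) ≠ i * 0 + k * 1) : coeff n (u ^ i * v ^ k) = 0 :=
    ((h0.pow i).mul (h1.pow k)).coeff_eq_zero (hn ▸ hne)
  have hvw (i k : ℕ) (hne : (4 : ZMod 5) ≠ i * 1 + k * 2) : coeff n (v ^ i * w ^ k) = 0 :=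
    ((h1.pow i).mul (h2.pow k)).coeff_eq_zero (hn ▸ hne)
  rw [hexp]
  simp only [map_add, map_sub, two_mul]
  rw [huv 4 0 (by decide), huv 2 2 (by decide), huv 1 3 (by decide), huv 3 1 (by decide),
    hvw 3 1 (by decide), hvw 2 2 (by decide), hvw 0 4 (by decide), hvw 1 3 (by decide)]
  simp

end Residue

section Multiset

variable {ι : Type*} (w : ι → ℕ)

/-- The multisets of total weight `n` with elements in `T`. -/
def weightedMultisets (T : Finset ι) (n : ℕ) : Set (Multiset ι) :=
  {M | (∀ x ∈ M, x ∈ T) ∧ (M.map w).sum = n}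

variable {w}

theorem weightedMultisets_empty (n : ℕ) :
    weightedMultisets w ∅ n = if n = 0 then {0} else ∅ := by
  ext M
  simp only [weightedMultisets, Set.mem_ofPred_eq, notMem_empty, imp_false,
    ← Multiset.eq_zero_iff_forall_notMem]
  split_ifs with h
  · simp only [Set.mem_singleton_iff, and_iff_left_iff_imp]
    rintro rfl
    simp [h]
  · simp only [Set.mem_empty_iff_false, iff_false, not_and]
    rintro rfl
    simpa using Ne.symm h

variable [DecidableEq ι] {T : Finset ι} {x : ι}

theorem weightedMultisets_insert (n : ℕ) :
    weightedMultisets w (insert x T) n = weightedMultisets w T n ∪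
      (if w x ≤ n then (x ::ₘ ·) '' weightedMultisets w (insert x T) (n - w x) else ∅) := by
  ext M
  simp only [weightedMultisets, Set.mem_union, Set.mem_ofPred_eq]
  constructor
  · rintro ⟨hM, rfl⟩
    by_cases hx : x ∈ M
    · obtain ⟨M, rfl⟩ := Multiset.exists_cons_of_mem hx
      right
      rw [if_pos (by simp)]
      exact ⟨M, ⟨fun y hy ↦ hM y (Multiset.mem_cons_of_mem hy), by simp⟩, rfl⟩
    · left
      refine ⟨fun y hy ↦ (mem_insert.1 (hM y hy)).resolve_left ?_, rfl⟩
      rintro rfl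
      exact hx hy
  · rintro (⟨hM, rfl⟩ | h)
    · exact ⟨fun y hy ↦ mem_insert_of_mem (hM y hy), rfl⟩
    · split_ifs at h with hn
      · obtain ⟨M, ⟨hM, hs⟩, rfl⟩ := h
        refine ⟨fun y hy ↦ ?_, by simp [hs, hn]⟩
        rcases Multiset.mem_cons.1 hy with rfl | hy
        · exact mem_insert_self _ _
        · exact hM y hy
      · exact absurd h (Set.notMem_empty M)

theorem finite_weightedMultisets (hw : ∀ x ∈ T, 0 < w x) (n : ℕ) :
    (weightedMultisets w T n).Finite := by
  induction T using Finset.induction_on generalizing n with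
  | empty =>
    rw [weightedMultisets_empty]
    split_ifs <;> simp
  | insert x T _ ih =>
    induction n using Nat.strong_induction_on with
    | _ n ihn =>
      rw [weightedMultisets_insert]
      refine (ih (fun y hy ↦ hw y (mem_insert_of_mem hy)) n).union ?_
      split_ifs with h
      · have := hw x (mem_insert_self x T)
        exact (ihn _ (by omega)).image _
      · exact Set.finite_empty

theorem ncard_weightedMultisets_insert (hw : ∀ y ∈ insert x T, 0 < w y) (hx : x ∉ T) (n : ℕ) :
    (weightedMultisets w (insert x T) n).ncard = (weightedMultisets w T n).ncard +
      if w x ≤ n then (weightedMultisets w (insert x T) (n - w x)).ncard else 0 := by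
  rw [weightedMultisets_insert]
  split_ifs with h
  · rw [Set.ncard_union_eq _ (finite_weightedMultisets
      (fun y hy ↦ hw y (mem_insert_of_mem hy)) n) ((finite_weightedMultisets hw _).image _),
      Set.ncard_image_of_injective _ fun _ _ ↦ (Multiset.cons_inj_right x).1]
    rw [Set.disjoint_left]
    rintro _ hM ⟨M, -, rfl⟩
    exact hx (hM.1 x (Multiset.mem_cons_self x M))
  · simp

/-- The generating function of multisets with elements in `T`, counted by weight. -/
theorem mk_ncard_weightedMultisets_mul_prod (R : Type*) [CommRing R] (hw : ∀ x ∈ T, 0 < w x) :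
    (PowerSeries.mk fun n ↦ ((weightedMultisets w T n).ncard : R)) *
      ∏ x ∈ T, (1 - X ^ w x) = 1 := by
  induction T using Finset.induction_on with
  | empty =>
    ext n
    rw [prod_empty, mul_one, coeff_mk, weightedMultisets_empty, coeff_one]
    split_ifs <;> simp
  | insert x T hx ih =>
    rw [prod_insert hx, ← mul_assoc]
    refine .trans ?_ (ih fun y hy ↦ hw y (mem_insert_of_mem hy))
    congr 1
    ext n
    rw [mul_sub, mul_one, map_sub, coeff_mul_X_pow', coeff_mk, coeff_mk,
      ncard_weightedMultisets_insert hw hx, sub_eq_iff_eq_add]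
    split_ifs <;> simp

end Multiset

/-- The coloured parts of size at most `K`, with `c` colours for even parts. -/
def coloredParts (c K : ℕ) : Finset (ℕ × ℕ) :=
  ((range K).map (addRightEmbedding 1) ×ˢ range c).filter fun x ↦ Even x.1 ∨ x.2 = 0

theorem cubicPartitionSet_eq {c n K : ℕ} (hc : 0 < c) (h : n ≤ K) :
    cubicPartitionSet c n = weightedMultisets Prod.fst (coloredParts c K) n := by
  ext M
  simp only [cubicPartitionSet, weightedMultisets, Set.mem_ofPred_eq]
  refine and_congr_left fun hM ↦ forall₂_congr fun x hx ↦ ?_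
  have hle : x.1 ≤ n := hM ▸ Multiset.le_sum_of_mem (Multiset.mem_map_of_mem Prod.fst hx)
  have hmem : x.1 ∈ (range K).map (addRightEmbedding 1) ↔ 0 < x.1 := by
    simp only [mem_map, mem_range, addRightEmbedding_apply]
    exact ⟨fun ⟨m, _, hm⟩ ↦ by omega, fun h0 ↦ ⟨x.1 - 1, by omega, by omega⟩⟩
  rw [coloredParts, mem_filter, mem_product, hmem, mem_range]
  split_ifs with he
  · simp [he]
  · simp only [he, false_or]
    grind

theorem prod_coloredParts (R : Type*) [CommRing R] (j K : ℕ) :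
    ∏ x ∈ coloredParts (5 * j + 1) K, (1 - X ^ x.1 : R⟦X⟧) =
      ((∏ k ∈ range K, if Even (k + 1) then (1 - X ^ (k + 1)) else 1) ^ j) ^ 5 *
        ∏ k ∈ range K, (1 - X ^ (k + 1)) := by
  rw [coloredParts, prod_filter, prod_product, prod_map, ← pow_mul, ← prod_pow, ← prod_mul_distrib]
  refine prod_congr rfl fun k _ ↦ ?_
  rw [prod_range_succ']
  simp [mul_comm j 5]

theorem coeff_pow_eq_of_forall_le {R : Type*} [CommRing R] {f g : R⟦X⟧} {n : ℕ}
    (h : ∀ m ≤ n, coeff m f = coeff m g) (d : ℕ) {m : ℕ} (hm : m ≤ n) :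
    coeff m (f ^ d) = coeff m (g ^ d) := by
  have hdvd : X ^ (n + 1) ∣ f - g :=
    X_pow_dvd_iff.2 fun m hm ↦ by rw [map_sub, h m (by omega), sub_self]
  have := X_pow_dvd_iff.1 (hdvd.trans (sub_dvd_pow_sub_pow f g d)) m (by omega)
  rwa [map_sub, sub_eq_zero] at this

theorem exists_coeff_prod_eq (R : Type*) [CommRing R] (n : ℕ) : ∃ K, n ≤ K ∧ ∀ m ≤ n,
    coeff m (∏ k ∈ range K, (1 - X ^ (k + 1) : R⟦X⟧)) = coeff m (pentagonalSeries R) := by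
  have h := (Filter.eventually_all_finset (range (n + 1))).2
    fun m _ ↦ coeff_prod_one_sub_X_pow_eventually_eq R m
  obtain ⟨K, hK, hn⟩ := ((Filter.tendsto_finset_range.eventually h).and
    (Filter.eventually_ge_atTop n)).exists
  exact ⟨K, hn, fun m hm ↦ hK m (by simp; omega)⟩

end CubicPartition

open CubicPartition PowerSeries in
/-- For all `j, n ≥ 0`, `a_{5j+1}(5n+4) ≡ 0 (mod 5)`. -/
theorem a_5j1_cong (j n : ℕ) : 5 ∣ a (5 * j + 1) (5 * n + 4) := by
  obtain ⟨K, hK, hcoeff⟩ := exists_coeff_prod_eq (ZMod 5) (5 * n + 4)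
  have hpos : ∀ x ∈ coloredParts (5 * j + 1) K, 0 < x.1 := by
    intro x hx
    simp only [coloredParts, Finset.mem_filter, Finset.mem_product, Finset.mem_map,
      addRightEmbedding_apply] at hx
    omega
  have hgen := mk_ncard_weightedMultisets_mul_prod (ZMod 5) hpos
  rw [prod_coloredParts] at hgen
  rw [← ZMod.natCast_eq_zero_iff, a, cubicPartitionSet_eq (by omega) hK,
    ← coeff_mk (5 * n + 4) fun m ↦
      ((weightedMultisets Prod.fst (coloredParts (5 * j + 1) K) m).ncard : ZMod 5)]
  set G := PowerSeries.mk fun m ↦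
    ((weightedMultisets Prod.fst (coloredParts (5 * j + 1) K) m).ncard : ZMod 5)
  set P : (ZMod 5)⟦X⟧ := ∏ k ∈ Finset.range K, (1 - X ^ (k + 1))
  set Q : (ZMod 5)⟦X⟧ :=
    (∏ k ∈ Finset.range K, if Even (k + 1) then (1 - X ^ (k + 1)) else 1) ^ j
  have hG : G = P ^ 4 * (G * Q ^ 4) ^ 5 := by
    calc G = G * (G * (Q ^ 5 * P)) ^ 4 := by rw [hgen, one_pow, mul_one]
      _ = _ := by ring
  rw [hG, coeff_mul]
  refine Finset.sum_eq_zero fun p hp ↦ ?_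
  have hp := Finset.HasAntidiagonal.mem_antidiagonal.1 hp
  by_cases h2 : (p.2 : ZMod 5) = 0
  · rw [coeff_pow_eq_of_forall_le hcoeff 4 (by omega), coeff_pentagonalSeries_pow_four, zero_mul]
    have := congrArg (Nat.cast : ℕ → ZMod 5) hp
    push_cast at this
    rw [h2, show (5 : ZMod 5) = 0 by decide] at this
    simpa using this
  · rw [(supportedOn_pow_five _).coeff_eq_zero h2, mul_zero]
end

section
/- For all j ≥ 0 and all n ≥ 0, a_{7j+1}(7n+5) ≡ 0 (mod 7). -/
open Finset

namespace GeneralizedCubicPartition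

section Jacobi

open Polynomial

variable {A : Type*} [CommRing A]

/-- The finite product `(1 - q) (1 - q ^ 2) ⋯ (1 - q ^ n)`. -/
def eulerProd (q : A) (n : ℕ) : A := ∏ k ∈ range n, (1 - q ^ (k + 1))

theorem eulerProd_succ (q : A) (n : ℕ) :
    eulerProd q (n + 1) = eulerProd q n * (1 - q ^ (n + 1)) :=
  prod_range_succ _ _

/-- The finite theta product `(1 - z) ∏ (1 - z q ^ k) (z - q ^ k)`, over `1 ≤ k ≤ n`. -/
noncomputable def thetaPoly (q : A) : ℕ → A[X]
  | 0 => 1 - X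
  | n + 1 => thetaPoly q n * ((1 - C (q ^ (n + 1)) * X) * (X - C (q ^ (n + 1))))

theorem thetaPoly_functional (q : A) (n : ℕ) :
    (X - C (q ^ n)) * (thetaPoly q n).comp (C q * X) =
      -C (q ^ n) * (1 - C (q ^ (n + 1)) * X) * thetaPoly q n := by
  induction n with
  | zero => simp [thetaPoly]; ring
  | succ n ih =>
    simp only [thetaPoly, mul_comp, sub_comp, one_comp, X_comp, C_comp]
    simp only [map_pow] at ih ⊢
    linear_combination C q * (X - C q ^ (n + 1)) * (1 - C q ^ (n + 1) * (C q * X)) * ih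

theorem thetaPoly_coeff_recurrence (q : A) (n m : ℕ) :
    q ^ n * (1 - q ^ (m + 1)) * (thetaPoly q n).coeff (m + 1) =
      -(q ^ m - q ^ (2 * n + 1)) * (thetaPoly q n).coeff m := by
  have h := congrArg (fun p => p.coeff (m + 1)) (thetaPoly_functional q n)
  have e : -C (q ^ n) * (1 - C (q ^ (n + 1)) * X) * thetaPoly q n =
      C (q ^ (2 * n + 1)) * (X * thetaPoly q n) - C (q ^ n) * thetaPoly q n := by
    simp only [map_pow]; ring
  rw [e] at h
  simp only [sub_mul, coeff_sub, coeff_X_mul, coeff_C_mul, comp_C_mul_X_coeff] at h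
  linear_combination h

theorem thetaPoly_coeff_zero (q : A) (n : ℕ) :
    (thetaPoly q n).coeff 0 = (-1) ^ n * q ^ (n * (n + 1) / 2) := by
  induction n with
  | zero => simp [thetaPoly]
  | succ n ih =>
    have : (n + 1) * (n + 1 + 1) / 2 = n * (n + 1) / 2 + (n + 1) := by
      rw [show (n + 1) * (n + 1 + 1) = n * (n + 1) + (n + 1) * 2 by ring,
        Nat.add_mul_div_right _ _ two_pos]
    simp only [thetaPoly, mul_coeff_zero, ih, coeff_sub, coeff_one_zero, coeff_X_zero, coeff_C_zero,
      this]
    ring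

theorem thetaPoly_eval_one (q : A) (n : ℕ) : (thetaPoly q n).eval 1 = 0 := by
  induction n with
  | zero => simp [thetaPoly]
  | succ n ih => simp [thetaPoly, ih]

theorem thetaPoly_derivative_eval_one (q : A) (n : ℕ) :
    (derivative (thetaPoly q n)).eval 1 = -eulerProd q n ^ 2 := by
  induction n with
  | zero => simp [thetaPoly, eulerProd]
  | succ n ih =>
    rw [thetaPoly, derivative_mul, eval_add, eval_mul, ih, eval_mul, eval_mul, thetaPoly_eval_one,
      eulerProd_succ]
    simp
    ring

theorem thetaPoly_natDegree_le (q : A) (n : ℕ) : (thetaPoly q n).natDegree ≤ 2 * n + 1 := by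
  induction n with
  | zero => rw [thetaPoly]; compute_degree
  | succ n ih =>
    have h : ((1 - C (q ^ (n + 1)) * X) * (X - C (q ^ (n + 1)))).natDegree ≤ 2 := by
      compute_degree
    exact (natDegree_mul_le_of_le ih h).trans (by lia)

theorem thetaPoly_reflect (q : A) (n : ℕ) :
    reflect (2 * n + 1) (thetaPoly q n) = -thetaPoly q n := by
  induction n with
  | zero =>
    have h1 : reflect 1 (1 : A[X]) = X := by simp
    have hX : reflect 1 (X : A[X]) = 1 := by simp
    simp [thetaPoly, reflect_sub, h1, hX]
  | succ n ih =>
    have h : ((1 - C (q ^ (n + 1)) * X) * (X - C (q ^ (n + 1)))).natDegree ≤ 2 := by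
      compute_degree
    have h2 : reflect 2 ((1 - C (q ^ (n + 1)) * X) * (X - C (q ^ (n + 1)))) =
      ((1 - C (q ^ (n + 1)) * X) * (X - C (q ^ (n + 1)))) := by
      have e : ((1 - C (q ^ (n + 1)) * X) * (X - C (q ^ (n + 1)))) =
        C (-q ^ (n + 1)) * X ^ 0 + C (1 + q ^ (n + 1) * q ^ (n + 1)) * X ^ 1
          + C (-q ^ (n + 1)) * X ^ 2 := by
        simp only [map_neg, map_add, map_mul, map_one]; ring
      rw [e, reflect_add, reflect_add, reflect_C_mul_X_pow, reflect_C_mul_X_pow,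
        reflect_C_mul_X_pow]
      simp [revAt_le]
      ring
    rw [thetaPoly, show 2 * (n + 1) + 1 = 2 * n + 1 + 2 by ring,
      reflect_mul _ _ (thetaPoly_natDegree_le q n) h, ih, h2, neg_mul]

theorem thetaPoly_coeff_symm (q : A) {n m : ℕ} (h : m ≤ 2 * n + 1) :
    (thetaPoly q n).coeff (2 * n + 1 - m) = -(thetaPoly q n).coeff m := by
  rw [← coeff_neg, ← thetaPoly_reflect, coeff_reflect, revAt_le h]

theorem eulerProd_sq (q : A) (n : ℕ) :
    eulerProd q n ^ 2 = ∑ r ∈ range (n + 1), (2 * r + 1) * (thetaPoly q n).coeff (n - r) := by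
  have h := thetaPoly_derivative_eval_one q n
  rw [derivative_eval, sum_over_range' _ (by simp) (2 * n + 2)
    (by have := thetaPoly_natDegree_le q n; lia)] at h
  rw [← neg_eq_iff_eq_neg] at h
  rw [← h, show 2 * n + 2 = (n + 1) + (n + 1) by ring, sum_range_add, ← sum_range_reflect,
    ← sum_add_distrib, ← sum_neg_distrib]
  refine sum_congr rfl fun r hr => ?_
  have hr' : r ≤ n := by simpa [Nat.lt_succ_iff] using hr
  have e := thetaPoly_coeff_symm q (n := n) (m := n - r) (by lia)
  rw [show 2 * n + 1 - (n - r) = n + 1 + r by lia] at e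
  rw [e, show n + 1 - 1 - r = n - r by lia]
  push_cast [Nat.cast_sub hr']
  ring

theorem thetaPoly_coeff_mul [IsDomain A] {q : A} (hq : q ≠ 0) (n m : ℕ) (h : m ≤ n) :
    (thetaPoly q n).coeff m * (eulerProd q m * eulerProd q (2 * n + 1 - m)) =
      (-1) ^ (n - m) * q ^ ((n - m) * (n - m + 1) / 2) * eulerProd q (2 * n + 1) := by
  induction m with
  | zero => simp [thetaPoly_coeff_zero, eulerProd]
  | succ m ih =>
    obtain ⟨r, rfl⟩ : ∃ r, n = m + 1 + r := ⟨n - (m + 1), by lia⟩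
    specialize ih (by lia)
    have hrec := thetaPoly_coeff_recurrence q (m + 1 + r) m
    rw [show m + 1 + r - m = r + 1 by lia,
      show 2 * (m + 1 + r) + 1 - m = (m + 2 * r + 2) + 1 by lia, eulerProd_succ,
      show (r + 1) * (r + 1 + 1) / 2 = r * (r + 1) / 2 + (r + 1) by
        rw [show (r + 1) * (r + 1 + 1) = r * (r + 1) + (r + 1) * 2 by ring,
          Nat.add_mul_div_right _ _ two_pos]] at ih
    rw [show m + 1 + r - (m + 1) = r by lia,
      show 2 * (m + 1 + r) + 1 - (m + 1) = m + 2 * r + 2 by lia, eulerProd_succ]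
    apply mul_left_cancel₀ (pow_ne_zero (m + 1 + r) hq)
    linear_combination (eulerProd q m * eulerProd q (m + 2 * r + 2)) * hrec - q ^ m * ih

theorem eulerProd_dvd_sub (q : A) {m n : ℕ} (h : m ≤ n) :
    q ^ (m + 1) ∣ eulerProd q n - eulerProd q m := by
  induction n, h using Nat.le_induction with
  | base => simp
  | succ n hmn ih =>
    rw [eulerProd_succ, show eulerProd q n * (1 - q ^ (n + 1)) - eulerProd q m =
      (eulerProd q n - eulerProd q m) - eulerProd q n * q ^ (n + 1) by ring]
    exact dvd_sub ih ((pow_dvd_pow q (by lia)).mul_left _)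

theorem isCoprime_eulerProd (q : A) (m n : ℕ) : IsCoprime (q ^ m) (eulerProd q n) := by
  refine IsCoprime.pow_left (IsCoprime.prod_right fun k _ => ⟨q ^ k, 1, by ring⟩)

theorem dvd_thetaPoly_coeff_mul_sub [IsDomain A] {q : A} (hq : q ≠ 0) {n r : ℕ} (h : r ≤ n) :
    q ^ (n + 1) ∣ (thetaPoly q n).coeff (n - r) * eulerProd q n -
      (-1) ^ r * q ^ (r * (r + 1) / 2) := by
  have key := thetaPoly_coeff_mul hq n (n - r) (by lia)
  rw [show n - (n - r) = r by lia, show 2 * n + 1 - (n - r) = n + r + 1 by lia] at key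
  refine ((isCoprime_eulerProd q (n + 1) (n - r)).mul_right
    (isCoprime_eulerProd q (n + 1) n)).dvd_of_dvd_mul_right ?_
  obtain ⟨u, hu⟩ := eulerProd_dvd_sub q (show n ≤ n + r + 1 by lia)
  obtain ⟨v, hv⟩ := eulerProd_dvd_sub q (show n ≤ 2 * n + 1 by lia)
  obtain ⟨w, hw⟩ := eulerProd_dvd_sub q (show n - r ≤ n by lia)
  have hT : n + 1 ≤ r * (r + 1) / 2 + (n - r + 1) := by
    have : r ≤ r * (r + 1) / 2 := by
      rw [Nat.le_div_iff_mul_le two_pos]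
      rcases r with _ | r <;> nlinarith
    lia
  obtain ⟨t, ht⟩ := pow_dvd_pow q hT
  rw [pow_add] at ht
  refine ⟨-(thetaPoly q n).coeff (n - r) * eulerProd q n * eulerProd q (n - r) * u
    + (-1) ^ r * q ^ (r * (r + 1) / 2) * v * eulerProd q n
    + (-1) ^ r * w * t * eulerProd q n, ?_⟩
  linear_combination (eulerProd q n) * key
    - (thetaPoly q n).coeff (n - r) * eulerProd q n * eulerProd q (n - r) * hu
    + (-1) ^ r * q ^ (r * (r + 1) / 2) * eulerProd q n * hv
    + (-1) ^ r * q ^ (r * (r + 1) / 2) * eulerProd q n * hw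
    + (-1) ^ r * w * eulerProd q n * ht

/-- Jacobi's identity for the cube of the Euler product, modulo `q ^ (n + 1)`. -/
theorem dvd_eulerProd_cube_sub [IsDomain A] {q : A} (hq : q ≠ 0) (n : ℕ) :
    q ^ (n + 1) ∣ eulerProd q n ^ 3 -
      ∑ r ∈ range (n + 1), (2 * r + 1) * ((-1) ^ r * q ^ (r * (r + 1) / 2)) := by
  rw [pow_succ (eulerProd q n), eulerProd_sq, sum_mul, ← sum_sub_distrib]
  refine dvd_sum fun r hr => ?_
  rw [mul_assoc, ← mul_sub]
  exact (dvd_thetaPoly_coeff_mul_sub hq (by simpa [Nat.lt_succ_iff] using hr)).mul_left _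

end Jacobi

section PowerSeries

open PowerSeries

instance : Fact (Nat.Prime 7) := ⟨by norm_num⟩

theorem odd_mul_odd_eq_zero_of_triangular (r s m : ℕ)
    (h : r * (r + 1) / 2 + s * (s + 1) / 2 = 7 * m + 5) :
    (2 * r + 1) * (2 * s + 1) = (0 : ZMod 7) := by
  have hr : r * (r + 1) / 2 * 2 = r * (r + 1) :=
    Nat.div_mul_cancel (Nat.even_mul_succ_self r).two_dvd
  have hs : s * (s + 1) / 2 * 2 = s * (s + 1) :=
    Nat.div_mul_cancel (Nat.even_mul_succ_self s).two_dvd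
  have e : r * (r + 1) + s * (s + 1) = 7 * (2 * m) + 10 := by lia
  have e' := congrArg (Nat.cast : ℕ → ZMod 7) e
  push_cast at e'
  rw [show (7 : ZMod 7) = 0 from rfl, zero_mul] at e'
  generalize (r : ZMod 7) = x at *
  generalize (s : ZMod 7) = y at *
  clear * - e'
  revert x y
  decide

theorem coeff_eulerProd_pow_six {m n : ℕ} (h : 7 * m + 5 ≤ n) :
    coeff (7 * m + 5) (eulerProd (X : (ZMod 7)⟦X⟧) n ^ 6) = 0 := by
  have hd := dvd_eulerProd_cube_sub (X_ne_zero : (X : (ZMod 7)⟦X⟧) ≠ 0) n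
  set J : (ZMod 7)⟦X⟧ :=
    ∑ r ∈ range (n + 1), (2 * (r : (ZMod 7)⟦X⟧) + 1) * ((-1) ^ r * X ^ (r * (r + 1) / 2)) with hJ
  have hd' : (X : (ZMod 7)⟦X⟧) ^ (n + 1) ∣ eulerProd X n ^ 6 - J * J := by
    rw [show eulerProd X n ^ 6 - J * J = (eulerProd X n ^ 3 - J) * (eulerProd X n ^ 3 + J) by ring]
    exact hd.mul_right _
  have h0 := X_pow_dvd_iff.mp hd' (7 * m + 5) (by lia)
  rw [map_sub, sub_eq_zero] at h0
  rw [h0, hJ, sum_mul_sum, map_sum]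
  refine sum_eq_zero fun r _ => ?_
  rw [map_sum]
  refine sum_eq_zero fun s _ => ?_
  have e : (2 * (r : (ZMod 7)⟦X⟧) + 1) * ((-1) ^ r * X ^ (r * (r + 1) / 2)) *
      ((2 * (s : (ZMod 7)⟦X⟧) + 1) * ((-1) ^ s * X ^ (s * (s + 1) / 2))) =
      C ((2 * (r : ZMod 7) + 1) * (2 * s + 1) * (-1) ^ (r + s)) *
        X ^ (r * (r + 1) / 2 + s * (s + 1) / 2) := by
    simp only [map_mul, map_add, map_pow, map_neg, map_one, map_natCast, map_ofNat]
    ring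
  rw [e, coeff_C_mul, coeff_X_pow]
  split_ifs with hc
  · rw [odd_mul_odd_eq_zero_of_triangular r s m hc.symm]; simp
  · simp

/-- The geometric series `∑ X ^ (k * i)`, for `k ≠ 0`. -/
noncomputable def geom (R : Type*) [CommRing R] (k : ℕ) : R⟦X⟧ :=
  PowerSeries.mk fun i => if k ∣ i then 1 else 0

theorem geom_mul_one_sub {R : Type*} [CommRing R] {k : ℕ} (hk : k ≠ 0) :
    geom R k * (1 - X ^ k) = 1 := by
  have h : geom R k = expand k hk (PowerSeries.mk 1) := by
    ext i
    rw [coeff_expand]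
    simp [geom]
  rw [h, ← expand_X (R := R) k hk, ← map_one (expand (R := R) k hk), ← map_sub, ← map_mul,
    mk_one_mul_one_sub_eq_one, map_one]

theorem geom_pow_seven {k : ℕ} (hk : k ≠ 0) :
    geom (ZMod 7) k ^ 7 = expand 7 (by norm_num) (geom (ZMod 7) k) := by
  have h1 := congrArg (· ^ 7) (geom_mul_one_sub (R := ZMod 7) hk)
  have h2 := congrArg (expand 7 (by norm_num)) (geom_mul_one_sub (R := ZMod 7) hk)
  have : CharP (ZMod 7)⟦X⟧ 7 := charP_of_injective_algebraMap
    (algebraMap (ZMod 7) (ZMod 7)⟦X⟧).injective 7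
  simp only [mul_pow, one_pow, sub_pow_char, map_mul, map_sub, map_one, map_pow, expand_X] at h1 h2
  rw [← pow_mul, mul_comm k 7, pow_mul] at h1
  linear_combination expand 7 (by norm_num) (geom (ZMod 7) k) * h1 - geom (ZMod 7) k ^ 7 * h2

theorem coeff_mul_expand_eq_zero {R : Type*} [CommRing R] {f g : R⟦X⟧} {n p b : ℕ} (hp : p ≠ 0)
    (hb : b < p) (hf : ∀ m ≤ n, coeff (p * m + b) f = 0) :
    coeff (p * n + b) (f * expand p hp g) = 0 := by
  rw [coeff_mul]
  refine sum_eq_zero fun ⟨i, j⟩ hij => ?_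
  rw [HasAntidiagonal.mem_antidiagonal] at hij
  by_cases hj : p ∣ j
  · obtain ⟨l, rfl⟩ := hj
    simp only at hij
    have hl : l ≤ n := by
      by_contra! hl
      have := Nat.mul_le_mul_left p (Nat.succ_le_of_lt hl)
      rw [Nat.succ_eq_add_one, mul_add] at this
      lia
    have : i = p * (n - l) + b := by
      rw [Nat.mul_sub]
      have := Nat.mul_le_mul_left p hl
      lia
    rw [this, hf _ (Nat.sub_le _ _), zero_mul]
  · rw [coeff_expand_of_not_dvd _ _ _ hj, mul_zero]

theorem coeff_prod_geom_eq_zero (j n : ℕ) :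
    coeff (7 * n + 5) (∏ k ∈ range (7 * n + 5),
      (geom (ZMod 7) (k + 1) * if Even (k + 1) then geom (ZMod 7) (k + 1) ^ (7 * j) else 1)) =
      0 := by
  have h : ∏ k ∈ range (7 * n + 5),
      (geom (ZMod 7) (k + 1) * if Even (k + 1) then geom (ZMod 7) (k + 1) ^ (7 * j) else 1) =
      eulerProd X (7 * n + 5) ^ 6 * expand 7 (by norm_num) (∏ k ∈ range (7 * n + 5),
        (geom (ZMod 7) (k + 1) * if Even (k + 1) then geom (ZMod 7) (k + 1) ^ j else 1)) := by
    rw [eulerProd, ← prod_pow, map_prod, ← prod_mul_distrib]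
    refine prod_congr rfl fun k _ => ?_
    rw [map_mul, ← geom_pow_seven k.succ_ne_zero, apply_ite (expand 7 _), map_pow,
      ← geom_pow_seven k.succ_ne_zero, map_one, ← mul_assoc, ← pow_mul, pow_succ (geom _ _) 6,
      ← mul_assoc, ← mul_pow, mul_comm (1 - _), geom_mul_one_sub k.succ_ne_zero, one_pow, one_mul]
  rw [h]
  exact coeff_mul_expand_eq_zero _ (by norm_num) fun m hm => coeff_eulerProd_pow_six (by lia)

/-- The coefficients of a product of geometric series count solutions of a linear equation. -/
theorem coeff_prod_geom {R ι : Type*} [CommRing R] [DecidableEq ι] (S : Finset ι) (w : ι → ℕ)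
    (n : ℕ) : coeff n (∏ s ∈ S, geom R (w s)) =
      #{l ∈ finsuppAntidiag S n | ∀ s ∈ S, w s ∣ l s} := by
  rw [coeff_prod, card_filter]
  push_cast
  refine sum_congr rfl fun l _ => ?_
  simp only [geom, coeff_mk]
  rw [prod_ite_zero]
  simp

end PowerSeries

/-- The coloured parts of size at most `n`, even parts having `c` colours. -/
def colouredParts (c n : ℕ) : Finset (ℕ × ℕ) :=
  {x ∈ Icc 1 n ×ˢ range c | Even x.1 ∨ x.2 = 0}

theorem mem_colouredParts {c n : ℕ} {x : ℕ × ℕ} (hc : 0 < c) : x ∈ colouredParts c n ↔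
    (0 < x.1 ∧ if Even x.1 then x.2 < c else x.2 = 0) ∧ x.1 ≤ n := by
  simp only [colouredParts, mem_filter, mem_product, mem_Icc, mem_range]
  split_ifs with h <;> simp only [h, true_or, false_or, and_true] <;> lia

theorem subset_colouredParts {c n : ℕ} (hc : 0 < c) {M : Multiset (ℕ × ℕ)}
    (hM : M ∈ cubicPartitionSet c n) : M.toFinset ⊆ colouredParts c n := by
  intro x hx
  rw [Multiset.mem_toFinset] at hx
  exact (mem_colouredParts hc).2 ⟨hM.1 x hx,
    hM.2 ▸ Multiset.le_sum_of_mem (Multiset.mem_map_of_mem Prod.fst hx)⟩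

theorem a_eq_card {c : ℕ} (hc : 0 < c) (n : ℕ) :
    a c n = #{l ∈ finsuppAntidiag (colouredParts c n) n | ∀ s ∈ colouredParts c n, s.1 ∣ l s} := by
  let φ : Multiset (ℕ × ℕ) → (ℕ × ℕ) →₀ ℕ := fun M =>
    Finsupp.onFinset M.toFinset (fun s => s.1 * M.count s) fun s hs =>
      Multiset.mem_toFinset.2 (Multiset.count_ne_zero.1 (right_ne_zero_of_mul hs))
  have hφ (M s) : φ M s = s.1 * M.count s := rfl
  have hinj : Set.InjOn φ (cubicPartitionSet c n) := by
    intro M hM M' hM' h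
    ext s
    have hs := DFunLike.congr_fun h s
    rw [hφ, hφ] at hs
    by_cases h0 : 0 < s.1
    · exact Nat.eq_of_mul_eq_mul_left h0 hs
    · rw [Multiset.count_eq_zero_of_notMem fun hm => h0 (hM.1 s hm).1,
        Multiset.count_eq_zero_of_notMem fun hm => h0 (hM'.1 s hm).1]
  rw [a, ← hinj.ncard_image, ← Set.ncard_coe_finset]
  congr 1
  ext l
  simp only [Set.mem_image, coe_filter, mem_finsuppAntidiag, Set.mem_ofPred_eq]
  constructor
  · rintro ⟨M, hM, rfl⟩
    refine ⟨⟨?_, Finsupp.support_onFinset_subset.trans (subset_colouredParts hc hM)⟩,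
      fun s _ => Dvd.intro _ rfl⟩
    conv_rhs => rw [← hM.2, sum_multiset_map_count]
    symm
    simp only [hφ, smul_eq_mul, mul_comm (Multiset.count _ _)]
    refine sum_subset (subset_colouredParts hc hM) fun s _ hs => ?_
    rw [Multiset.count_eq_zero_of_notMem (by simpa using hs), mul_zero]
  · rintro ⟨⟨hsum, hsupp⟩, hdvd⟩
    let M : Multiset (ℕ × ℕ) := ∑ s ∈ colouredParts c n, Multiset.replicate (l s / s.1) s
    have hcount (s) : M.count s = if s ∈ colouredParts c n then l s / s.1 else 0 := by
      simp [M, Multiset.count_sum', Multiset.count_replicate]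
    have hmem (s) (hs : s ∈ M) : s ∈ colouredParts c n := by
      by_contra h
      exact Multiset.count_ne_zero.2 hs (by rw [hcount, if_neg h])
    refine ⟨M, ⟨fun s hs => ((mem_colouredParts hc).1 (hmem s hs)).1, ?_⟩, ?_⟩
    · rw [← hsum, ← Multiset.coe_mapAddMonoidHom, map_sum, Multiset.sum_sum]
      refine sum_congr rfl fun s hs => ?_
      simp [Nat.div_mul_cancel (hdvd s hs)]
    · ext s
      rw [hφ, hcount]
      split_ifs with hs
      · exact Nat.mul_div_cancel' (hdvd s hs)
      · rw [mul_zero, Finsupp.notMem_support_iff.1 fun h => hs (hsupp h)]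

theorem prod_colouredParts {R : Type*} [CommRing R] (f : ℕ → R) (c n : ℕ) :
    ∏ s ∈ colouredParts (c + 1) n, f s.1 =
      ∏ k ∈ range n, (f (k + 1) * if Even (k + 1) then f (k + 1) ^ c else 1) := by
  rw [colouredParts, prod_filter, prod_product, range_eq_Ico (a := n),
    prod_Ico_add' (fun k => f k * if Even k then f k ^ c else 1) 0 n 1, zero_add,
    Ico_add_one_right_eq_Icc]
  refine prod_congr rfl fun k _ => ?_
  rw [prod_range_succ', mul_comm]
  by_cases hk : Even k <;> simp [hk]

end GeneralizedCubicPartition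

open GeneralizedCubicPartition in
/-- For all `j, n ≥ 0`, `a_{7j+1}(7n+5) ≡ 0 (mod 7)`. -/
theorem a_7j1_cong (j n : ℕ) : 7 ∣ a (7 * j + 1) (7 * n + 5) := by
  rw [← ZMod.natCast_eq_zero_iff, a_eq_card (Nat.succ_pos _), ← coeff_prod_geom,
    prod_colouredParts (geom (ZMod 7)), coeff_prod_geom_eq_zero]
end

section
/- For all j ≥ 0 and all n ≥ 0, a_{11j+1}(11n+6) ≡ 0 (mod 11). -/
open PowerSeries Finset

theorem coeff_pow_char_eq_zero {R : Type*} [CommRing R] [IsDomain R] (p : ℕ) [CharP R p]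
    (f : R⟦X⟧) {n : ℕ} (hn : ¬ p ∣ n) : coeff n (f ^ p) = 0 := by
  obtain _ | n := n
  · simp at hn
  have h : coeff n (derivative R (f ^ p)) = 0 := by
    have : ((p : ℕ) : R⟦X⟧) = 0 := by
      rw [← map_natCast (C (R := R)), CharP.cast_eq_zero, map_zero]
    rw [derivative_pow, this]
    simp
  rw [coeff_derivative] at h
  refine (mul_eq_zero.mp h).resolve_right fun h' => hn ?_
  rw [← CharP.cast_eq_zero_iff R p]
  exact_mod_cast h'

/-- The part of a power series supported on the exponents in the residue class `r`. -/
noncomputable def residuePart {R : Type*} [CommRing R] {m : ℕ} (r : ZMod m) (f : R⟦X⟧) : R⟦X⟧ :=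
  mk fun n => if (n : ZMod m) = r then coeff n f else 0

theorem coeff_residuePart {R : Type*} [CommRing R] {m : ℕ} (r : ZMod m) (f : R⟦X⟧) (n : ℕ) :
    coeff n (residuePart r f) = if (n : ZMod m) = r then coeff n f else 0 := by
  rw [residuePart, coeff_mk]

theorem residuePart_eq_zero_iff {R : Type*} [CommRing R] {m : ℕ} {r : ZMod m} {f : R⟦X⟧} :
    residuePart r f = 0 ↔ ∀ n : ℕ, (n : ZMod m) = r → coeff n f = 0 := by
  simp [PowerSeries.ext_iff, coeff_residuePart]

theorem residuePart_mul {R : Type*} [CommRing R] {m : ℕ} [NeZero m] (r : ZMod m) (f g : R⟦X⟧) :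
    residuePart r (f * g) = ∑ s, residuePart s f * residuePart (r - s) g := by
  ext n
  simp only [coeff_residuePart, map_sum, coeff_mul, ite_mul, zero_mul]
  rw [Finset.sum_comm]
  simp only [Finset.sum_ite_eq, Finset.mem_univ, if_true, mul_ite, mul_zero]
  have key (x : ℕ × ℕ) (hx : x ∈ antidiagonal n) :
      ((x.2 : ZMod m) = r - x.1) = ((n : ZMod m) = r) := by
    rw [← HasAntidiagonal.mem_antidiagonal.mp hx, Nat.cast_add, eq_sub_iff_add_eq']
  split_ifs with h
  · exact Finset.sum_congr rfl fun x hx => (if_pos ((key x hx).mpr h)).symm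
  · exact (Finset.sum_eq_zero fun x hx => if_neg ((key x hx).mp.mt h)).symm

theorem residuePart_mul_of_support {R : Type*} [CommRing R] {m : ℕ} [NeZero m]
    {s : Finset (ZMod m)} {f : R⟦X⟧} (hf : ∀ r ∉ s, residuePart r f = 0) (r : ZMod m)
    (g : R⟦X⟧) :
    residuePart r (f * g) = ∑ t ∈ s, residuePart t f * residuePart (r - t) g := by
  rw [residuePart_mul]
  exact (Finset.sum_subset s.subset_univ fun t _ ht => by rw [hf t ht, zero_mul]).symm

theorem residuePart_six_pow_seven {f : (ZMod 11)⟦X⟧}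
    (hf : ∀ r ∉ ({0, 1, 3, 6, 10} : Finset (ZMod 11)), residuePart r f = 0)
    (hf4 : ∀ r ∉ ({0, 1, 2, 4, 5, 7} : Finset (ZMod 11)), residuePart r (f ^ 4) = 0) :
    residuePart (6 : ZMod 11) (f ^ 7) = 0 := by
  have h11 : (11 : (ZMod 11)⟦X⟧) = 0 := by
    rw [← map_ofNat (C (R := ZMod 11)), show (OfNat.ofNat 11 : ZMod 11) = 0 from rfl, map_zero]
  have h2 (r : ZMod 11) := residuePart_mul_of_support hf r f
  have h3 (r : ZMod 11) := residuePart_mul_of_support hf r (f * f)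
  have h4 (r : ZMod 11) := residuePart_mul_of_support hf r (f * (f * f))
  have h7 := residuePart_mul_of_support hf4 6 (f * (f * f))
  rw [show f ^ 4 = f * (f * (f * f)) by ring] at hf4 h7
  rw [show f ^ 7 = f * (f * (f * f)) * (f * (f * f)) by ring, h7]
  have g3 := hf4 3 (by decide)
  have g6 := hf4 6 (by decide)
  have g8 := hf4 8 (by decide)
  have g9 := hf4 9 (by decide)
  have g10 := hf4 10 (by decide)
  have k2 := hf 2 (by decide)
  have k4 := hf 4 (by decide)
  have k5 := hf 5 (by decide)
  have k7 := hf 7 (by decide)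
  have k8 := hf 8 (by decide)
  have k9 := hf 9 (by decide)
  clear hf hf4 h7
  have exp5 (F : ZMod 11 → (ZMod 11)⟦X⟧) : ∑ t ∈ ({0, 1, 3, 6, 10} : Finset (ZMod 11)), F t =
      F 0 + (F 1 + (F 3 + (F 6 + F 10))) := by
    repeat rw [Finset.sum_insert (by decide)]
    rw [Finset.sum_singleton]
  have exp6 (F : ZMod 11 → (ZMod 11)⟦X⟧) : ∑ t ∈ ({0, 1, 2, 4, 5, 7} : Finset (ZMod 11)), F t =
      F 0 + (F 1 + (F 2 + (F 4 + (F 5 + F 7)))) := by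
    repeat rw [Finset.sum_insert (by decide)]
    rw [Finset.sum_singleton]
  simp only [exp5] at h2 h3 h4
  simp only [exp6, h4, h3, h2] at g3 g6 g8 g9 g10 ⊢
  reduce_mod_char at g3 g6 g8 g9 g10 ⊢
  simp only [k2, k4, k5, k7, k8, k9, mul_zero, add_zero, zero_add] at g3 g6 g8 g9 g10 ⊢
  clear h2 h3 h4 k2 k4 k5 k7 k8 k9 exp5 exp6
  generalize residuePart (0 : ZMod 11) f = a, residuePart (1 : ZMod 11) f = b,
    residuePart (3 : ZMod 11) f = c,
    residuePart (6 : ZMod 11) f = d, residuePart (10 : ZMod 11) f = e at *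
  linear_combination (4 * b * c * e - 2 * b ^ 3 + a ^ 2 * c) * g3 +
    (d ^ 2 * e + 4 * a * b * e - 2 * a ^ 3) * g6
    + (-2 * c ^ 3 + a * e ^ 2 + 4 * a * c * d) * g8 + (-2 * e ^ 3 + 4 * c * d * e + b ^ 2 * d) *
    g9 + (-2 * d ^ 3 + b * c ^ 2 + 4 * a * b * d) * g10 + (d ^ 5 * e ^ 2 + c * d ^ 6 + c ^ 6 * e
    + b * e ^ 6 + 14 * b * c * d * e ^ 4 + 18 * b * c ^ 2 * d ^ 2 * e ^ 2 + 12 * b * c ^ 3 * d ^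
    3 + b ^ 2 * c ^ 5 + 12 * b ^ 3 * d * e ^ 3 + 20 * b ^ 3 * c * d ^ 2 * e + b ^ 5 * d ^ 2 + 12
    * a * c ^ 3 * e ^ 3 + 14 * a * c ^ 4 * d * e + 20 * a * b * d ^ 3 * e ^ 2 + 14 * a * b * c *
    d ^ 4 + 18 * a * b ^ 2 * c ^ 2 * e ^ 2 + 20 * a * b ^ 2 * c ^ 3 * d + 14 * a * b ^ 4 * c * e
    + a * b ^ 6 + a ^ 2 * e ^ 5 + 20 * a ^ 2 * c * d * e ^ 3 + 18 * a ^ 2 * c ^ 2 * d ^ 2 * e +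
    18 * a ^ 2 * b ^ 2 * d * e ^ 2 + 18 * a ^ 2 * b ^ 2 * c * d ^ 2 + 12 * a ^ 3 * d ^ 3 * e +
    20 * a ^ 3 * b * c ^ 2 * e + 12 * a ^ 3 * b ^ 3 * c + 14 * a ^ 4 * b * d * e + a ^ 5 * c ^ 2
    + a ^ 6 * d) * h11

/-- The Gaussian binomial coefficient, defined by the `q`-Pascal recursion. -/
def gaussBinom {A : Type*} [CommRing A] (q : A) : ℕ → ℕ → A
  | _, 0 => 1
  | 0, _ + 1 => 0
  | n + 1, k + 1 => gaussBinom q n k + q ^ (k + 1) * gaussBinom q n (k + 1)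

@[simp]
theorem gaussBinom_zero_right {A : Type*} [CommRing A] (q : A) (n : ℕ) : gaussBinom q n 0 = 1 := by
  cases n <;> rfl

theorem gaussBinom_succ_succ {A : Type*} [CommRing A] (q : A) (n k : ℕ) :
    gaussBinom q (n + 1) (k + 1) = gaussBinom q n k + q ^ (k + 1) * gaussBinom q n (k + 1) :=
  rfl

theorem gaussBinom_eq_zero_of_lt {A : Type*} [CommRing A] (q : A) {n k : ℕ} (h : n < k) :
    gaussBinom q n k = 0 := by
  induction n generalizing k with
  | zero =>
    obtain ⟨k, rfl⟩ := Nat.exists_eq_add_of_lt h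
    simp [gaussBinom]
  | succ n ih =>
    obtain _ | k := k
    · simp at h
    · rw [gaussBinom_succ_succ, ih (by omega), ih (by omega), mul_zero, add_zero]

theorem map_gaussBinom {A B : Type*} [CommRing A] [CommRing B] (φ : A →+* B) (q : A) (n k : ℕ) :
    φ (gaussBinom q n k) = gaussBinom (φ q) n k := by
  induction n generalizing k with
  | zero => cases k <;> simp [gaussBinom]
  | succ n ih => cases k <;> simp [gaussBinom, ih]

/-- The `q`-binomial theorem. -/
theorem prod_add_mul_pow_eq_sum_gaussBinom {A : Type*} [CommRing A] (q x y : A) (m : ℕ) :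
    ∏ i ∈ range m, (y + x * q ^ i) =
      ∑ k ∈ range (m + 1), q ^ k.choose 2 * gaussBinom q m k * x ^ k * y ^ (m - k) := by
  induction m generalizing x with
  | zero => simp
  | succ m ih =>
    have h (i : ℕ) : y + x * q ^ (i + 1) = y + x * q * q ^ i := by ring
    have h2 (k : ℕ) : (k + 1).choose 2 = k.choose 2 + k := by
      rw [Nat.choose_succ_succ' k 1, Nat.choose_one_right, add_comm]
    rw [prod_range_succ']
    simp only [h]
    rw [ih, sum_range_succ' _ (m + 1), pow_zero, mul_one, mul_add]
    have hy : (∑ k ∈ range (m + 1),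
        q ^ k.choose 2 * gaussBinom q m k * (x * q) ^ k * y ^ (m - k)) * y =
        ∑ k ∈ range (m + 1), q ^ ((k + 1).choose 2 + (k + 1)) * gaussBinom q m (k + 1) *
          x ^ (k + 1) * y ^ (m - k) + y ^ (m + 1) := by
      rw [sum_range_succ', sum_range_succ _ m, gaussBinom_eq_zero_of_lt q (Nat.lt_succ_self m),
        add_mul, sum_mul]
      simp only [mul_zero, zero_mul, add_zero]
      congr 1
      · refine sum_congr rfl fun k hk => ?_
        rw [show m - k = m - (k + 1) + 1 by have := mem_range.mp hk; omega]
        ring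
      · simp [pow_succ]
    rw [hy, sum_mul, add_right_comm, ← sum_add_distrib]
    congr 1
    · refine sum_congr rfl fun k hk => ?_
      rw [gaussBinom_succ_succ, h2, Nat.add_sub_add_right]
      ring
    · simp

/-- The finite `q`-Pochhammer symbol `(q; q)_n`. -/
def qPochhammer {A : Type*} [CommRing A] (q : A) (n : ℕ) : A :=
  ∏ i ∈ range n, (1 - q ^ (i + 1))

theorem qPochhammer_succ {A : Type*} [CommRing A] (q : A) (n : ℕ) :
    qPochhammer q (n + 1) = qPochhammer q n * (1 - q ^ (n + 1)) :=
  prod_range_succ ..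

theorem gaussBinom_self {A : Type*} [CommRing A] (q : A) (n : ℕ) : gaussBinom q n n = 1 := by
  induction n with
  | zero => simp
  | succ n ih => rw [gaussBinom_succ_succ, ih, gaussBinom_eq_zero_of_lt q n.lt_succ_self]; simp

theorem gaussBinom_mul_qPochhammer {A : Type*} [CommRing A] (q : A) (a b : ℕ) :
    gaussBinom q (a + b) a * (qPochhammer q a * qPochhammer q b) = qPochhammer q (a + b) := by
  induction h : a + b generalizing a b with
  | zero =>
    obtain ⟨rfl, rfl⟩ := Nat.add_eq_zero_iff.mp h
    simp [qPochhammer]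
  | succ n ih =>
    obtain _ | a := a
    · simp [← h, qPochhammer]
    obtain _ | b := b
    · simp [← h, gaussBinom_self, qPochhammer]
    have h1 := ih a (b + 1) (by omega)
    have h2 := ih (a + 1) b (by omega)
    obtain rfl : n = a + b + 1 := by omega
    rw [gaussBinom_succ_succ, qPochhammer_succ q (a + b + 1)]
    rw [qPochhammer_succ q b] at h1 ⊢
    rw [qPochhammer_succ q a] at h2 ⊢
    linear_combination (1 - q ^ (a + 1)) * h1 + q ^ (a + 1) * (1 - q ^ (b + 1)) * h2

theorem choose_two_add (a b : ℕ) : (a + b).choose 2 = a.choose 2 + b.choose 2 + a * b := by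
  induction b with
  | zero => simp
  | succ b ih =>
    rw [← add_assoc, Nat.choose_succ_succ' (a + b) 1, Nat.choose_succ_succ' b 1, ih,
      Nat.choose_one_right, Nat.choose_one_right]
    ring

theorem two_mul_choose_two_add_self (a : ℕ) : 2 * a.choose 2 + a = a * a := by
  induction a with
  | zero => simp
  | succ a ih =>
    rw [choose_two_add, Nat.choose_eq_zero_of_lt one_lt_two]
    linarith

theorem prod_pow_sub_pow_eq_qPochhammer {A : Type*} [CommRing A] (q : A) (n : ℕ) :
    ∏ i ∈ range n, (q ^ n - q ^ i) = (-1) ^ n * q ^ n.choose 2 * qPochhammer q n := by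
  have h : ∏ i ∈ range n, q ^ (n - 1 - i) = q ^ n.choose 2 := by
    rw [prod_range_reflect (fun i => q ^ i), prod_pow_eq_pow_sum, sum_range_id,
      Nat.choose_two_right]
  have h' : ∏ _i ∈ range n, (-1 : A) = (-1) ^ n := by simp
  rw [← prod_range_reflect, ← h, qPochhammer, ← h', ← prod_mul_distrib, ← prod_mul_distrib]
  refine prod_congr rfl fun i hi => ?_
  obtain ⟨k, rfl⟩ := Nat.exists_eq_add_of_lt (mem_range.mp hi)
  rw [show i + k + 1 - 1 - i = k by omega]
  ring

/-- A finite form of Jacobi's identity for the cube of the Euler function. -/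
theorem qPochhammer_sq_eq_sum_gaussBinom {A : Type*} [CommRing A] {q : A} (hq : IsLeftRegular q)
    (n : ℕ) :
    qPochhammer q n ^ 2 = ∑ j ∈ range (n + 1), (-1) ^ j * q ^ (j + 1).choose 2 *
      ((n + 1 + j) * gaussBinom q (2 * n + 1) (n + 1 + j) -
        (n - j) * gaussBinom q (2 * n + 1) (n - j)) := by
  have key := congrArg (fun p => (Polynomial.derivative p).eval 1)
    (prod_add_mul_pow_eq_sum_gaussBinom (Polynomial.C q) (-Polynomial.X) (Polynomial.C (q ^ n))
      (n + 1 + n))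
  have hl : (Polynomial.derivative (∏ i ∈ range (n + 1 + n),
      (Polynomial.C (q ^ n) + -Polynomial.X * Polynomial.C q ^ i))).eval 1 =
      -((-1) ^ n * q ^ (n + n.choose 2 + n * n) * qPochhammer q n ^ 2) := by
    rw [prod_range_add, prod_range_succ]
    have h1 : (∏ i ∈ range n, (q ^ n - q ^ (n + 1 + i))) = q ^ (n * n) * qPochhammer q n := by
      have h' : ∏ _i ∈ range n, q ^ n = q ^ (n * n) := by simp [pow_mul]
      rw [← h', qPochhammer, ← prod_mul_distrib]
      exact prod_congr rfl fun i _ => by ring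
    simp only [Polynomial.derivative_mul, Polynomial.eval_add, Polynomial.eval_mul,
      Polynomial.eval_prod, Polynomial.eval_C, Polynomial.eval_pow, Polynomial.eval_neg,
      Polynomial.eval_X, Polynomial.derivative_add, Polynomial.derivative_C,
      Polynomial.derivative_neg, Polynomial.derivative_X, Polynomial.derivative_pow,
      neg_one_mul, ← sub_eq_add_neg, h1, prod_pow_sub_pow_eq_qPochhammer]
    simp
    ring
  have hr (k : ℕ) : (Polynomial.derivative (Polynomial.C q ^ k.choose 2 *
      gaussBinom (Polynomial.C q) (n + 1 + n) k * (-Polynomial.X) ^ k *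
      Polynomial.C (q ^ n) ^ (n + 1 + n - k))).eval 1 =
      (-1) ^ k * k * q ^ (k.choose 2 + n * (n + 1 + n - k)) * gaussBinom q (n + 1 + n) k := by
    rw [← map_gaussBinom, neg_pow, pow_add, pow_mul,
      show Polynomial.C q ^ k.choose 2 * Polynomial.C (gaussBinom q (n + 1 + n) k) *
        ((-1) ^ k * Polynomial.X ^ k) * Polynomial.C (q ^ n) ^ (n + 1 + n - k) =
        Polynomial.C ((-1) ^ k * q ^ k.choose 2 * (q ^ n) ^ (n + 1 + n - k) *
          gaussBinom q (n + 1 + n) k) * Polynomial.X ^ k by simp; ring,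
      Polynomial.derivative_C_mul_X_pow]
    simp
    ring
  simp only [Polynomial.derivative_sum, Polynomial.eval_finsetSum, hr, hl] at key
  rw [show n + 1 + n + 1 = n + 1 + (n + 1) by ring, sum_range_add,
    ← sum_range_reflect _ (n + 1), ← sum_add_distrib] at key
  apply hq.pow (n + n.choose 2 + n * n)
  have hs : ((-1 : A) ^ n) * (-1) ^ n = 1 := by rw [← mul_pow]; simp
  rw [neg_eq_iff_eq_neg] at key
  have e : q ^ (n + n.choose 2 + n * n) * qPochhammer q n ^ 2 =
      (-1) ^ n * ((-1) ^ n * q ^ (n + n.choose 2 + n * n) * qPochhammer q n ^ 2) := by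
    linear_combination -(q ^ (n + n.choose 2 + n * n) * qPochhammer q n ^ 2) * hs
  simp only [mul_sum]
  rw [e, key, mul_neg, ← neg_mul, mul_sum]
  refine sum_congr rfl fun j hj => ?_
  obtain ⟨i, rfl⟩ := Nat.exists_eq_add_of_le (Nat.lt_succ_iff.mp (mem_range.mp hj))
  have hi : ((-1 : A) ^ i) * (-1) ^ i = 1 := by rw [← mul_pow]; simp
  have hj : ((-1 : A) ^ j) * (-1) ^ j = 1 := by rw [← mul_pow]; simp
  have c1 := choose_two_add j i
  have c2 := choose_two_add j 1
  have c3 := choose_two_add (j + i) (j + 1)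
  have c4 := two_mul_choose_two_add_self j
  have c5 := Nat.choose_eq_zero_of_lt one_lt_two
  have e1 : i.choose 2 + (j + i) * (j + i + 1 + j) =
      (j + i) + (j + i).choose 2 + (j + i) * (j + i) + (j + 1).choose 2 := by
    linarith
  have e2 : (j + i + 1 + j).choose 2 + (j + i) * i =
      (j + i) + (j + i).choose 2 + (j + i) * (j + i) + (j + 1).choose 2 := by
    rw [show j + i + 1 + j = j + i + (j + 1) by ring]
    linarith
  rw [show j + i + 1 - 1 - j = i by omega, show j + i - j = i by omega,
    show j + i + 1 + (j + i) - i = j + i + 1 + j by omega,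
    show j + i + 1 + (j + i) - (j + i + 1 + j) = i by omega,
    show 2 * (j + i) + 1 = j + i + 1 + (j + i) by ring, e1, e2]
  generalize gaussBinom q (j + i + 1 + (j + i)) i = G
  generalize gaussBinom q (j + i + 1 + (j + i)) (j + i + 1 + j) = H
  rw [pow_add _ _ ((j + 1).choose 2)]
  generalize q ^ (j + i + (j + i).choose 2 + (j + i) * (j + i)) = Q
  push_cast
  simp only [pow_add, pow_one]
  linear_combination
    (-(-1) ^ j * i * G * hi + (-1) ^ j * (j + i + 1 + j) * H * ((-1) ^ j * (-1) ^ j * hi + hj)) *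
      Q * q ^ (j + 1).choose 2

theorem X_pow_dvd_qPochhammer_sub {R : Type*} [CommRing R] {m n : ℕ} (h : m ≤ n) :
    (X : R⟦X⟧) ^ (m + 1) ∣ qPochhammer X n - qPochhammer X m := by
  induction n, h using Nat.le_induction with
  | base => simp
  | succ n hmn ih =>
    rw [qPochhammer_succ, show qPochhammer (X : R⟦X⟧) n * (1 - X ^ (n + 1)) - qPochhammer X m =
      qPochhammer X n - qPochhammer X m - X ^ (n + 1) * qPochhammer X n by ring]
    exact dvd_sub ih ((pow_dvd_pow X (by omega)).mul_right _)

theorem isUnit_qPochhammer {R : Type*} [CommRing R] (n : ℕ) :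
    IsUnit (qPochhammer (X : R⟦X⟧) n) := by
  simp [PowerSeries.isUnit_iff_constantCoeff, qPochhammer]

theorem X_pow_dvd_gaussBinom_mul_qPochhammer_sub_one {R : Type*} [CommRing R] {m a b n : ℕ}
    (ha : m ≤ a) (hb : m ≤ b) (hn : m ≤ n) :
    (X : R⟦X⟧) ^ (m + 1) ∣ gaussBinom X (a + b) a * qPochhammer X n - 1 := by
  have h {k : ℕ} (hk : m ≤ k) := (Ideal.Quotient.mk_eq_mk_iff_sub_mem _ _).mpr
    (Ideal.mem_span_singleton.mpr (X_pow_dvd_qPochhammer_sub (R := R) hk))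
  rw [← Ideal.mem_span_singleton, ← Ideal.Quotient.mk_eq_mk_iff_sub_mem]
  have key := congrArg (Ideal.Quotient.mk (Ideal.span {(X : R⟦X⟧) ^ (m + 1)}))
    (gaussBinom_mul_qPochhammer (X : R⟦X⟧) a b)
  simp only [map_mul, map_one, h ha, h hb, h hn, h (ha.trans (Nat.le_add_right a b))] at key ⊢
  refine ((isUnit_qPochhammer (R := R) m).map (Ideal.Quotient.mk _)).mul_right_cancel ?_
  linear_combination key

theorem X_pow_dvd_pentagonalSeries_sub (R : Type*) [CommRing R] (n : ℕ) :
    X ^ (n + 1) ∣ pentagonalSeries R - qPochhammer X n := by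
  rw [X_pow_dvd_iff]
  intro k hk
  obtain ⟨s, hs⟩ := Filter.eventually_atTop.mp (coeff_prod_one_sub_X_pow_eventually_eq R k)
  obtain ⟨b, hb⟩ := s.exists_nat_subset_range
  have h := hs (range (b + n)) (hb.trans (range_mono (Nat.le_add_right b n)))
  have h2 := X_pow_dvd_iff.mp (X_pow_dvd_qPochhammer_sub (R := R) (Nat.le_add_left n b)) k hk
  rw [map_sub, ← h, ← h2, map_sub, qPochhammer, qPochhammer]

/-- **Jacobi's identity** for the cube of the Euler function, up to order `n`. -/
theorem X_pow_dvd_pentagonalSeries_pow_three_sub (R : Type*) [CommRing R] (n : ℕ) :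
    X ^ (n + 1) ∣ pentagonalSeries R ^ 3 -
      ∑ j ∈ range (n + 1), C ((-1) ^ j * (2 * j + 1) : R) * X ^ (j + 1).choose 2 := by
  have h1 : X ^ (n + 1) ∣ pentagonalSeries R ^ 3 - qPochhammer X n ^ 3 :=
    (X_pow_dvd_pentagonalSeries_sub R n).trans (sub_dvd_pow_sub_pow ..)
  have hX : IsLeftRegular (X : R⟦X⟧) := fun a b h => X_mul_cancel h
  have h2 : X ^ (n + 1) ∣ qPochhammer X n ^ 3 -
      ∑ j ∈ range (n + 1), C ((-1) ^ j * (2 * j + 1) : R) * X ^ (j + 1).choose 2 := by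
    rw [pow_succ (qPochhammer _ _), qPochhammer_sq_eq_sum_gaussBinom hX, sum_mul, ← sum_sub_distrib]
    refine dvd_sum fun j hj => ?_
    obtain ⟨i, rfl⟩ := Nat.exists_eq_add_of_le (Nat.lt_succ_iff.mp (mem_range.mp hj))
    obtain ⟨u, hu⟩ := X_pow_dvd_gaussBinom_mul_qPochhammer_sub_one (R := R) (m := i)
      (a := j + i + 1 + j) (b := i) (n := j + i) (by omega) (by omega) (by omega)
    obtain ⟨v, hv⟩ := X_pow_dvd_gaussBinom_mul_qPochhammer_sub_one (R := R) (m := i)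
      (a := i) (b := j + i + 1 + j) (n := j + i) (by omega) (by omega) (by omega)
    rw [show j + i + 1 + j + i = 2 * (j + i) + 1 by ring] at hu
    rw [show i + (j + i + 1 + j) = 2 * (j + i) + 1 by ring] at hv
    rw [show j + i - j = i by omega, Nat.choose_succ_succ' j 1, Nat.choose_one_right]
    refine ⟨(-1) ^ j * X ^ j.choose 2 *
      ((2 * (j : R⟦X⟧) + (i : R⟦X⟧) + 1) * u - (i : R⟦X⟧) * v), ?_⟩
    simp only [map_mul, map_pow, map_neg, map_one, map_add, map_ofNat, map_natCast]
    push_cast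
    linear_combination (-1) ^ j * X ^ (j + j.choose 2) *
      ((2 * (j : R⟦X⟧) + (i : R⟦X⟧) + 1) * hu - (i : R⟦X⟧) * hv)
  simpa using dvd_add h1 h2

theorem exists_of_coeff_pentagonalSeries_pow_three_ne_zero {R : Type*} [CommRing R] {n : ℕ}
    (h : coeff n (pentagonalSeries R ^ 3) ≠ 0) :
    ∃ j : ℕ, n = (j + 1).choose 2 ∧ (2 * j + 1 : R) ≠ 0 := by
  have h1 := X_pow_dvd_iff.mp (X_pow_dvd_pentagonalSeries_pow_three_sub R n) n n.lt_succ_self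
  rw [map_sub, sub_eq_zero] at h1
  rw [h1, map_sum] at h
  obtain ⟨j, -, hj⟩ := exists_ne_zero_of_sum_ne_zero h
  rw [coeff_C_mul, coeff_X_pow] at hj
  refine ⟨j, ?_, fun h0 => hj ?_⟩
  · by_contra hne
    simp [hne] at hj
  · rw [h0, mul_zero, zero_mul]

/-- Multisets with elements in `S` and total weight `n`. -/
def weightedMultisets {ι : Type*} (w : ι → ℕ) (S : Finset ι) (n : ℕ) : Set (Multiset ι) :=
  {M | (∀ x ∈ M, x ∈ S) ∧ (M.map w).sum = n}

theorem weightedMultisets_empty {ι : Type*} (w : ι → ℕ) (n : ℕ) :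
    weightedMultisets w ∅ n = if n = 0 then {0} else ∅ := by
  ext M
  have : (∀ x ∈ M, x ∈ (∅ : Finset ι)) ↔ M = 0 := by
    simp [Multiset.eq_zero_iff_forall_notMem]
  rw [weightedMultisets, Set.mem_ofPred_eq, this]
  split_ifs with h
  · simpa [h] using fun h' : M = 0 => by simp [h']
  · simp only [Set.mem_empty_iff_false, iff_false]
    rintro ⟨rfl, h'⟩
    exact h (by simpa using h'.symm)

theorem weightedMultisets_insert {ι : Type*} [DecidableEq ι] (w : ι → ℕ) {S : Finset ι} {a : ι}
    (n : ℕ) :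
    weightedMultisets w (insert a S) n = weightedMultisets w S n ∪
      if w a ≤ n then (a ::ₘ ·) '' weightedMultisets w (insert a S) (n - w a) else ∅ := by
  ext M
  constructor
  · rintro ⟨hM, rfl⟩
    by_cases ha : a ∈ M
    · obtain ⟨M, rfl⟩ := Multiset.exists_cons_of_mem ha
      right
      rw [if_pos (by simp)]
      exact ⟨M, ⟨fun x hx => hM x (Multiset.mem_cons_of_mem hx), by simp⟩, rfl⟩
    · exact Or.inl ⟨fun x hx => (mem_insert.mp (hM x hx)).resolve_left (by grind), rfl⟩
  · rintro (⟨hM, rfl⟩ | h)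
    · exact ⟨fun x hx => mem_insert_of_mem (hM x hx), rfl⟩
    · split_ifs at h with hw
      · obtain ⟨M, ⟨hM, hs⟩, rfl⟩ := h
        refine ⟨fun x hx => ?_, by simp [hs, hw]⟩
        rcases Multiset.mem_cons.mp hx with rfl | hx
        · exact mem_insert_self _ _
        · exact hM x hx
      · simp at h

theorem weightedMultisets_finite {ι : Type*} {w : ι → ℕ} {S : Finset ι}
    (hw : ∀ x ∈ S, 0 < w x) (n : ℕ) : (weightedMultisets w S n).Finite := by
  classical
  induction S using Finset.induction_on generalizing n with
  | empty => rw [weightedMultisets_empty]; split_ifs <;> simp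
  | insert a S ha ih =>
    induction n using Nat.strong_induction_on with
    | _ n ihn =>
      rw [weightedMultisets_insert]
      refine (ih (fun x hx => hw x (mem_insert_of_mem hx)) n).union ?_
      split_ifs with h
      · exact (ihn _ (Nat.sub_lt_self (hw a (mem_insert_self a S)) h)).image _
      · exact Set.finite_empty

theorem ncard_weightedMultisets_insert {ι : Type*} [DecidableEq ι] {w : ι → ℕ} {S : Finset ι}
    {a : ι} (ha : a ∉ S) (hw : ∀ x ∈ insert a S, 0 < w x) (n : ℕ) :
    (weightedMultisets w (insert a S) n).ncard = (weightedMultisets w S n).ncard +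
      if w a ≤ n then (weightedMultisets w (insert a S) (n - w a)).ncard else 0 := by
  rw [weightedMultisets_insert, Set.ncard_union_eq ?_
    (weightedMultisets_finite (fun x hx => hw x (mem_insert_of_mem hx)) n) ?_]
  · split_ifs
    · rw [Set.ncard_image_of_injective _ fun M N h => (Multiset.cons_inj_right a).mp h]
    · rw [Set.ncard_empty]
  · rw [Set.disjoint_left]
    rintro M ⟨hM, -⟩ h
    split_ifs at h
    · obtain ⟨N, -, rfl⟩ := h
      exact ha (hM a (Multiset.mem_cons_self a N))
    · exact h
  · split_ifs
    · exact (weightedMultisets_finite hw _).image _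
    · exact Set.finite_empty

/-- The generating function of multisets with elements in `S`, counted by weight. -/
theorem mk_ncard_weightedMultisets_mul_prod (R : Type*) [CommRing R] {ι : Type*} {w : ι → ℕ}
    {S : Finset ι} (hw : ∀ x ∈ S, 0 < w x) :
    (mk fun n => ((weightedMultisets w S n).ncard : R)) * ∏ x ∈ S, (1 - X ^ w x) = 1 := by
  classical
  induction S using Finset.induction_on with
  | empty =>
    ext n
    rw [prod_empty, mul_one, coeff_mk, weightedMultisets_empty, coeff_one]
    split_ifs <;> simp
  | insert a S ha ih =>
    refine Eq.trans ?_ (ih fun x hx => hw x (mem_insert_of_mem hx))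
    rw [prod_insert ha, ← mul_assoc]
    congr 1
    ext n
    rw [mul_sub, mul_one, map_sub, coeff_mul_X_pow', coeff_mk, coeff_mk,
      ncard_weightedMultisets_insert ha hw]
    split_ifs <;> simp

theorem residuePart_pow_char_of_ne_zero {R : Type*} [CommRing R] [IsDomain R] {p : ℕ} [CharP R p]
    {r : ZMod p} (hr : r ≠ 0) (f : R⟦X⟧) : residuePart r (f ^ p) = 0 := by
  refine residuePart_eq_zero_iff.mpr fun n hn => coeff_pow_char_eq_zero p f fun h => hr ?_
  rw [← hn, (CharP.cast_eq_zero_iff (ZMod p) p n).mpr h]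

theorem residuePart_pow_char_mul {R : Type*} [CommRing R] [IsDomain R] {p : ℕ} [NeZero p]
    [CharP R p] (r : ZMod p) (f g : R⟦X⟧) :
    residuePart r (f ^ p * g) = residuePart (0 : ZMod p) (f ^ p) * residuePart r g := by
  rw [residuePart_mul_of_support (s := {0}) fun r hr =>
    residuePart_pow_char_of_ne_zero (by simpa using hr) f, sum_singleton, sub_zero]

instance : Fact (Nat.Prime 11) := ⟨by norm_num⟩

theorem residuePart_pentagonalSeries_eq_zero (r : ZMod 11)
    (hr : r ∉ ({0, 1, 2, 4, 5, 7} : Finset (ZMod 11))) :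
    residuePart r (pentagonalSeries (ZMod 11)) = 0 := by
  refine residuePart_eq_zero_iff.mpr fun n hn => coeff_pentagonalSeries_eq_zero _ ?_
  rintro ⟨k, rfl⟩
  have h := congrArg (Int.cast : ℤ → ZMod 11) (two_mul_natCast_pentagonal k)
  push_cast at h
  rw [hn] at h
  clear hn
  generalize (k : ZMod 11) = l at h
  revert r l
  decide

theorem residuePart_pentagonalSeries_pow_three_eq_zero (r : ZMod 11)
    (hr : r ∉ ({0, 1, 3, 6, 10} : Finset (ZMod 11))) :
    residuePart r (pentagonalSeries (ZMod 11) ^ 3) = 0 := by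
  refine residuePart_eq_zero_iff.mpr fun n hn => ?_
  by_contra h
  obtain ⟨j, rfl, hj⟩ := exists_of_coeff_pentagonalSeries_pow_three_ne_zero h
  have h2 := congrArg (Nat.cast : ℕ → ZMod 11) (two_mul_choose_two_add_self (j + 1))
  push_cast at h2
  rw [hn] at h2
  clear hn h
  generalize (j : ZMod 11) = j at h2 hj
  revert r j
  decide

theorem residuePart_six_pentagonalSeries_pow :
    residuePart (6 : ZMod 11) (pentagonalSeries (ZMod 11) ^ 21) = 0 := by
  rw [show 21 = 3 * 7 from rfl, pow_mul]
  refine residuePart_six_pow_seven residuePart_pentagonalSeries_pow_three_eq_zero fun r hr => ?_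
  rw [← pow_mul, show 3 * 4 = 11 + 1 from rfl, pow_succ, residuePart_pow_char_mul,
    residuePart_pentagonalSeries_eq_zero r hr, mul_zero]

/-- The admissible parts of size at most `n`, with their colors. -/
def coloredParts (c n : ℕ) : Finset (ℕ × ℕ) :=
  (Icc 1 n ×ˢ range c).filter fun x => Even x.1 ∨ x.2 = 0

theorem cubicPartitionSet_eq_weightedMultisets {c : ℕ} (hc : 0 < c) (n : ℕ) :
    cubicPartitionSet c n = weightedMultisets Prod.fst (coloredParts c n) n := by
  ext M
  refine and_congr_left fun hs => forall₂_congr fun x hx => ?_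
  have h : x.1 ≤ n :=
    hs ▸ Multiset.single_le_sum (fun _ _ => Nat.zero_le _) _ (Multiset.mem_map_of_mem _ hx)
  simp only [coloredParts, mem_filter, mem_product, mem_Icc, mem_range]
  split_ifs with he <;> grind

theorem prod_coloredParts {R : Type*} [CommRing R] (m n : ℕ) :
    ∏ x ∈ coloredParts (m + 1) n, (1 - X ^ x.1 : R⟦X⟧) =
      (∏ i ∈ Icc 1 n, if Even i then 1 - X ^ i else 1) ^ m * qPochhammer X n := by
  have h : qPochhammer (X : R⟦X⟧) n = ∏ i ∈ Icc 1 n, (1 - X ^ i) := by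
    induction n with
    | zero => simp [qPochhammer]
    | succ n ih => rw [prod_Icc_succ_top (by omega), ← ih, qPochhammer_succ]
  rw [coloredParts, prod_filter, prod_product, h, ← prod_pow, ← prod_mul_distrib]
  refine prod_congr rfl fun i _ => ?_
  rw [prod_range_succ']
  simp

/-- For all `j, n ≥ 0`, `a_{11j+1}(11n+6) ≡ 0 (mod 11)`. -/
theorem a_11j1_cong (j n : ℕ) : 11 ∣ a (11 * j + 1) (11 * n + 6) := by
  rw [← CharP.cast_eq_zero_iff (ZMod 11) 11, a, cubicPartitionSet_eq_weightedMultisets (by omega)]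
  set N := 11 * n + 6 with hN
  set P := pentagonalSeries (ZMod 11)
  have hF := mk_ncard_weightedMultisets_mul_prod (ZMod 11) (w := Prod.fst)
    (S := coloredParts (11 * j + 1) N) fun x hx => by
      simp only [coloredParts, mem_filter, mem_product, mem_Icc] at hx
      exact hx.1.1.1
  rw [← coeff_mk N fun k => ((weightedMultisets Prod.fst (coloredParts (11 * j + 1) N) k).ncard :
    ZMod 11)]
  generalize (PowerSeries.mk fun k => ((weightedMultisets Prod.fst
    (coloredParts (11 * j + 1) N) k).ncard : ZMod 11)) = F at hF ⊢
  rw [prod_coloredParts, mul_comm 11 j, pow_mul] at hF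
  generalize (∏ i ∈ Icc 1 N, if Even i then 1 - X ^ i else 1 : (ZMod 11)⟦X⟧) ^ j = H at hF
  have hdvd : X ^ (N + 1) ∣ (F ^ 2 * H ^ 21) ^ 11 * P ^ 21 - F := by
    have h1 : X ^ (N + 1) ∣ P ^ 21 - qPochhammer X N ^ 21 :=
      (X_pow_dvd_pentagonalSeries_sub _ N).trans (sub_dvd_pow_sub_pow ..)
    have h2 : F = F * (F * (H ^ 11 * qPochhammer X N)) ^ 21 := by rw [hF, one_pow, mul_one]
    convert h1.mul_left ((F ^ 2 * H ^ 21) ^ 11) using 1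
    linear_combination -h2
  have h6 := residuePart_eq_zero_iff.mp (show residuePart (6 : ZMod 11)
    ((F ^ 2 * H ^ 21) ^ 11 * P ^ 21) = 0 by
      rw [residuePart_pow_char_mul, residuePart_six_pentagonalSeries_pow, mul_zero]) N (by
      rw [hN, Nat.cast_add, Nat.cast_mul, CharP.cast_eq_zero, zero_mul, zero_add]
      rfl)
  rw [← h6, ← sub_eq_zero, ← map_sub, ← neg_sub, map_neg,
    X_pow_dvd_iff.mp hdvd N N.lt_succ_self, neg_zero]
end
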